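/- Let 𝒫 be an admissible family of positive cones, let A, A', B, B' be finite-dimensional C*-algebras, let φ ∈ L(A,B), and let α : A' → A and β : B → B' each be a trace preserving map that is either a 𝒫-channel or a completely positive channel. Then ‖β∘φ∘α‖_◇ ≤ ‖φ‖_◇ and ‖β∘φ∘α‖^◇ ≤ ‖φ‖^◇. -/

import Mathlib

noncomputable section

open Matrix Complex Filter
open scoped Kronecker ComplexOrder

/-- The positive semidefinite square root of a positive semidefinite matrix (the definition of the
older Mathlib, since removed). -/
def Matrix.PosSemidef.sqrt {n 𝕜 : Type*} [Fintype n] [RCLike 𝕜] [DecidableEq n]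
    {A : Matrix n n 𝕜} (hA : A.PosSemidef) : Matrix n n 𝕜 :=
  (hA.1.eigenvectorUnitary : Matrix n n 𝕜) *
    Matrix.diagonal (fun i => ((Real.sqrt (hA.1.eigenvalues i) : ℝ) : 𝕜)) *
    (star hA.1.eigenvectorUnitary : Matrix n n 𝕜)

/-- The algebra `B(H)` of operators on the Hilbert space with orthonormal basis indexed by `ι`,
modelled as matrices. -/
abbrev Mat (ι : Type) : Type := Matrix ι ι ℂ

/-- The space of all maps `B(H) → B(K)`. -/
abbrev HMap (ι κ : Type) : Type := Mat ι → Mat κ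

section Defs
variable {ι κ μ ν γ γ' : Type}

/-- A Hermitian (i.e. complex-linear and Hermiticity preserving) map `B(H) → B(K)`. -/
def IsHermMap [Fintype ι] [Fintype κ] (φ : HMap ι κ) : Prop :=
  IsLinearMap ℂ φ ∧ ∀ a : Mat ι, φ aᴴ = (φ a)ᴴ

/-- The real vector space `L(H,K)` of Hermitian maps, as a subset of all maps. -/
def LHK (ι κ : Type) [Fintype ι] [Fintype κ] : Set (HMap ι κ) := {φ | IsHermMap φ}

/-- The functional `s(φ) = ∑_{i,j} ⟨e_i, φ(|e_i⟩⟨e_j|) e_j⟩`. -/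
def sC [Fintype ι] [DecidableEq ι] (φ : HMap ι ι) : ℂ :=
  ∑ i, ∑ j, φ (Matrix.single i j 1) i j

/-- The duality pairing `⟨φ,ψ⟩ = s(ψ ∘ φ)` between `L(H,K)` and `L(K,H)`. -/
def pairing [Fintype ι] [DecidableEq ι] [Fintype κ] (φ : HMap ι κ) (ψ : HMap κ ι) : ℝ :=
  (sC (ψ ∘ φ)).re

/-- The map `φ ⊗ id_F`. -/
def tensorId (φ : HMap ι κ) (γ : Type) : Mat (ι × γ) → Mat (κ × γ) :=
  fun M => Matrix.of fun p q => φ (Matrix.of fun i i' => M (i, p.2) (i', q.2)) p.1 q.1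

/-- The map `id ⊗ f` on `B(H ⊗ D)`. -/
def idTensor (ι : Type) (f : HMap γ γ') : Mat (ι × γ) → Mat (ι × γ') :=
  fun M => Matrix.of fun p q => f (Matrix.of fun c c' => M (p.1, c) (q.1, c')) p.2 q.2

/-- The tensor product `φ ⊗ ξ` of two maps. -/
def tensorFun [Fintype ι] [DecidableEq ι] (φ : HMap ι κ) (ξ : HMap γ γ') :
    Mat (ι × γ) → Mat (κ × γ') :=
  fun M => Matrix.of fun p q =>
    ∑ i, ∑ i', φ (Matrix.single i i' 1) p.1 q.1 *
      ξ (Matrix.of fun c c' => M (i, c) (i', c')) p.2 q.2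

/-- The Choi matrix `C(φ) = (φ ⊗ id)(X_H)` of a map `φ : B(H) → B(K)`. -/
def Choi [DecidableEq ι] (φ : HMap ι κ) : Mat (κ × ι) :=
  Matrix.of fun p q => φ (Matrix.single p.2 q.2 1) p.1 q.1

/-- The adjoint of a map with respect to the Hilbert-Schmidt inner products. -/
def adjFun [Fintype ι] [Fintype κ] [DecidableEq ι] (φ : HMap ι κ) : HMap κ ι :=
  fun b => Matrix.of fun i j => (φ (Matrix.single j i 1) * b).trace

/-- Trace preserving maps. -/
def TP [Fintype ι] [Fintype κ] (φ : HMap ι κ) : Prop := ∀ a, (φ a).trace = a.trace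

/-- The cone `Pos(H,K)` of positive Hermitian maps. -/
def PosSet (ι κ : Type) [Fintype ι] [Fintype κ] : Set (HMap ι κ) :=
  {φ | IsHermMap φ ∧ ∀ a, a.PosSemidef → (φ a).PosSemidef}

/-- The cone `CP(H,K)` of completely positive Hermitian maps. -/
def CPSet (ι κ : Type) [Fintype ι] [Fintype κ] : Set (HMap ι κ) :=
  {φ | IsHermMap φ ∧ ∀ (n : ℕ) (M : Mat (ι × Fin n)),
      M.PosSemidef → (tensorId φ (Fin n) M).PosSemidef}

/-- The cone `EB(H,K)` of entanglement breaking maps `a ↦ ∑_i Tr(F_i a) ρ_i`. -/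
def EBSet (ι κ : Type) [Fintype ι] [Fintype κ] : Set (HMap ι κ) :=
  {φ | ∃ (N : ℕ) (F : Fin N → Mat ι) (ρ : Fin N → Mat κ),
      (∀ i, (F i).PosSemidef) ∧ (∀ i, (ρ i).PosSemidef) ∧
      φ = fun a => ∑ i, ((F i * a).trace) • ρ i}

/-- Interior of `Q` relative to the subset `L`. -/
def relInt {X : Type*} [TopologicalSpace X] (L Q : Set X) : Set X :=
  {x | x ∈ Q ∧ Q ∈ nhdsWithin x L}

/-- A proper cone in the (sub)space `L`: closed, convex, closed under nonnegative scalar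
multiples, pointed, and with nonempty interior relative to `L`. -/
def IsProperConeIn {X : Type*} [TopologicalSpace X] [AddCommGroup X] [Module ℝ X]
    (L Q : Set X) : Prop :=
  Q ⊆ L ∧ IsClosed Q ∧ Convex ℝ Q ∧ (∀ c : ℝ, 0 ≤ c → ∀ x ∈ Q, c • x ∈ Q) ∧
    (∀ x, x ∈ Q → -x ∈ Q → x = 0) ∧ (relInt L Q).Nonempty

end Defs

/-- An admissible family of positive cones: a proper cone `Pf(H,K) ⊆ L(H,K)` for every pair of
(finite-dimensional) Hilbert spaces, with `EB ⊆ Pf ⊆ Pos`, closed under composition and under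
composition with completely positive maps. -/
structure AdmissibleFamily : Type 1 where
  P : ∀ (ι κ : Type) [Fintype ι] [DecidableEq ι] [Fintype κ] [DecidableEq κ], Set (HMap ι κ)
  proper : ∀ (ι κ : Type) [Fintype ι] [DecidableEq ι] [Fintype κ] [DecidableEq κ],
    IsProperConeIn (LHK ι κ) (P ι κ)
  eb_le : ∀ (ι κ : Type) [Fintype ι] [DecidableEq ι] [Fintype κ] [DecidableEq κ],
    EBSet ι κ ⊆ P ι κ
  le_pos : ∀ (ι κ : Type) [Fintype ι] [DecidableEq ι] [Fintype κ] [DecidableEq κ],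
    P ι κ ⊆ PosSet ι κ
  comp_mem : ∀ (ι κ μ : Type) [Fintype ι] [DecidableEq ι] [Fintype κ] [DecidableEq κ]
      [Fintype μ] [DecidableEq μ],
    ∀ φ ∈ P ι κ, ∀ ψ ∈ P κ μ, (ψ ∘ φ) ∈ P ι μ
  cp_comp_mem : ∀ (ι κ μ ν : Type) [Fintype ι] [DecidableEq ι] [Fintype κ] [DecidableEq κ]
      [Fintype μ] [DecidableEq μ] [Fintype ν] [DecidableEq ν],
    ∀ β ∈ CPSet ι κ, ∀ φ ∈ P κ μ, ∀ α ∈ CPSet μ ν, (α ∘ φ ∘ β) ∈ P ι ν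

structure FdSubalgebra (ι : Type) [Fintype ι] [DecidableEq ι] : Type where
  car : Set (Mat ι)
  add_mem : ∀ {x y}, x ∈ car → y ∈ car → x + y ∈ car
  smul_mem : ∀ (c : ℂ) {x}, x ∈ car → c • x ∈ car
  one_mem : (1 : Mat ι) ∈ car
  mul_mem : ∀ {x y}, x ∈ car → y ∈ car → x * y ∈ car
  star_mem : ∀ {x}, x ∈ car → xᴴ ∈ car
  E : Mat ι → Mat ι
  E_linear : IsLinearMap ℂ E
  E_mem : ∀ x, E x ∈ car
  E_fix : ∀ x ∈ car, E x = x
  E_trace : ∀ x y, y ∈ car → (E x * y).trace = (x * y).trace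

namespace FdSubalgebra

set_option linter.unusedSectionVars false
variable {ι γ : Type} [Fintype ι] [DecidableEq ι] [Fintype γ] [DecidableEq γ]

lemma zero_mem (A : FdSubalgebra ι) : (0 : Mat ι) ∈ A.car := by
  simpa using A.smul_mem 0 A.one_mem

lemma sum_mem (A : FdSubalgebra ι) {α : Type*} {s : Finset α} {f : α → Mat ι}
    (h : ∀ a ∈ s, f a ∈ A.car) : (∑ a ∈ s, f a) ∈ A.car :=
  Finset.sum_induction f (· ∈ A.car) (fun _ _ hx hy => A.add_mem hx hy) A.zero_mem h

/-- The full matrix algebra `B(H)`. -/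
def full (ι : Type) [Fintype ι] [DecidableEq ι] : FdSubalgebra ι where
  car := Set.univ
  add_mem := fun _ _ => Set.mem_univ _
  smul_mem := by intro _ x _; exact Set.mem_univ _
  one_mem := Set.mem_univ _
  mul_mem := fun _ _ => Set.mem_univ _
  star_mem := fun _ => Set.mem_univ _
  E := id
  E_linear := ⟨fun _ _ => rfl, fun _ _ => rfl⟩
  E_mem := fun _ => trivial
  E_fix := fun _ _ => rfl
  E_trace := fun _ _ _ => rfl

/-- The diagonal subalgebra `𝔻_n ⊆ B(ℂ^n)`. -/
def diag (n : ℕ) : FdSubalgebra (Fin n) where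
  car := {M | ∀ i j, i ≠ j → M i j = 0}
  add_mem := by
    intro x y hx hy i j hij
    simp [hx i j hij, hy i j hij]
  smul_mem := by
    intro c x hx i j hij
    simp [hx i j hij]
  one_mem := by
    intro i j hij
    exact Matrix.one_apply_ne hij
  mul_mem := by
    intro x y hx hy i j hij
    show ∑ k, x i k * y k j = 0
    refine Finset.sum_eq_zero fun k _ => ?_
    rcases eq_or_ne k i with rfl | hk
    · simp [hy k j hij]
    · simp [hx i k (Ne.symm hk)]
  star_mem := by
    intro x hx i j hij
    simp [Matrix.conjTranspose_apply, hx j i (Ne.symm hij)]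
  E := fun M => Matrix.diagonal fun i => M i i
  E_linear := by
    constructor
    · intro x y
      ext i j
      by_cases h : i = j <;> simp [Matrix.diagonal, h]
    · intro c x
      ext i j
      by_cases h : i = j <;> simp [Matrix.diagonal, h]
  E_mem := by
    intro x i j hij
    simp [Matrix.diagonal_apply_ne _ hij]
  E_fix := by
    intro x hx
    ext i j
    by_cases h : i = j
    · subst h; simp
    · simp [Matrix.diagonal_apply_ne _ h, hx i j h]
  E_trace := by
    intro x y hy
    have key : ∀ z : Mat (Fin n), (z * y).trace = ∑ i, z i i * y i i := by
      intro z
      simp only [Matrix.trace, Matrix.diag, Matrix.mul_apply]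
      refine Finset.sum_congr rfl fun i _ => ?_
      refine Finset.sum_eq_single i (fun k _ hk => ?_) (by simp)
      simp [hy k i hk]
    rw [key, key]
    refine Finset.sum_congr rfl fun i _ => ?_
    simp


/-- The `(c,d)` block of a matrix on `H ⊗ D`. -/
def blk (M : Mat (ι × γ)) (c d : γ) : Mat ι := Matrix.of fun i j => M (i, c) (j, d)

lemma blk_add (M N : Mat (ι × γ)) (c d : γ) : blk (M + N) c d = blk M c d + blk N c d := by
  ext i j; simp [blk]

lemma blk_smul (a : ℂ) (M : Mat (ι × γ)) (c d : γ) : blk (a • M) c d = a • blk M c d := by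
  ext i j; simp [blk]

lemma blk_mul (M N : Mat (ι × γ)) (c d : γ) :
    blk (M * N) c d = ∑ e, blk M c e * blk N e d := by
  ext i j
  simp only [blk, Matrix.of_apply, Matrix.mul_apply, Matrix.sum_apply, Fintype.sum_prod_type]
  exact Finset.sum_comm

lemma trace_blk (M : Mat (ι × γ)) : M.trace = ∑ c, (blk M c c).trace := by
  simp only [Matrix.trace, Matrix.diag, blk, Matrix.of_apply, Fintype.sum_prod_type]
  exact Finset.sum_comm

/-- The tensor product algebra `A ⊗ B(D) ⊆ B(H ⊗ D)`. -/
def tensorFull (A : FdSubalgebra ι) (γ : Type) [Fintype γ] [DecidableEq γ] :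
    FdSubalgebra (ι × γ) where
  car := {M | ∀ c d, blk M c d ∈ A.car}
  add_mem := by
    intro x y hx hy c d
    rw [blk_add]; exact A.add_mem (hx c d) (hy c d)
  smul_mem := by
    intro a x hx c d
    rw [blk_smul]; exact A.smul_mem a (hx c d)
  one_mem := by
    intro c d
    rcases eq_or_ne c d with rfl | hcd
    · have : blk (1 : Mat (ι × γ)) c c = 1 := by
        ext i j
        by_cases h : i = j
        · subst h; simp [blk, Matrix.one_apply]
        · simp [blk, Matrix.one_apply, h]
      rw [this]; exact A.one_mem
    · have : blk (1 : Mat (ι × γ)) c d = 0 := by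
        ext i j
        simp [blk, Matrix.one_apply, hcd]
      rw [this]; exact A.zero_mem
  mul_mem := by
    intro x y hx hy c d
    rw [blk_mul]
    exact A.sum_mem fun e _ => A.mul_mem (hx c e) (hy e d)
  star_mem := by
    intro x hx c d
    have : blk xᴴ c d = (blk x d c)ᴴ := by
      ext i j; simp [blk, Matrix.conjTranspose_apply]
    rw [this]; exact A.star_mem (hx d c)
  E := fun M => Matrix.of fun p q => A.E (blk M p.2 q.2) p.1 q.1
  E_linear := by
    constructor
    · intro x y
      ext p q
      simp [blk_add, (A.E_linear.map_add _ _)]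
    · intro a x
      ext p q
      simp [blk_smul, (A.E_linear.map_smul _ _)]
  E_mem := by
    intro x c d
    have : blk (Matrix.of fun p q => A.E (blk x p.2 q.2) p.1 q.1) c d = A.E (blk x c d) := by
      ext i j; simp [blk]
    rw [this]; exact A.E_mem _
  E_fix := by
    intro x hx
    ext p q
    show A.E (blk x p.2 q.2) p.1 q.1 = x p q
    rw [A.E_fix _ (hx p.2 q.2)]
    rfl
  E_trace := by
    intro x y hy
    have key : ∀ z : Mat (ι × γ), (z * y).trace = ∑ c, ∑ d, (blk z c d * blk y d c).trace := by
      intro z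
      rw [trace_blk (z * y)]
      refine Finset.sum_congr rfl fun c _ => ?_
      rw [blk_mul, Matrix.trace_sum]
    rw [key, key]
    refine Finset.sum_congr rfl fun c _ => ?_
    refine Finset.sum_congr rfl fun d _ => ?_
    have hblk : blk (Matrix.of fun p q => A.E (blk x p.2 q.2) p.1 q.1) c d = A.E (blk x c d) := by
      ext i j; simp [blk]
    rw [hblk, A.E_trace _ _ (hy d c)]

end FdSubalgebra


section Main
variable {ι κ μ ν γ γ' : Type}
variable [Fintype ι] [DecidableEq ι] [Fintype κ] [DecidableEq κ]

/-- The subspace `L(A,B)` of maps identified with `E_B ∘ φ ∘ E_A`. -/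
def LAB (A : FdSubalgebra ι) (B : FdSubalgebra κ) : Set (HMap ι κ) :=
  {φ | (∀ a, φ a ∈ B.car) ∧ ∀ a, φ (A.E a) = φ a}

/-- The density operators (states) of the algebra `A`. -/
def States (A : FdSubalgebra ι) : Set (Mat ι) :=
  {σ | σ ∈ A.car ∧ σ.PosSemidef ∧ σ.trace = 1}

/-- The map `Φ_{I,σ} : a ↦ (Tr a) σ`. -/
def PhiI (ι : Type) [Fintype ι] (σ : Mat κ) : HMap ι κ := fun a => a.trace • σ

/-- The cone `Pf(A,B) = Pf(H,K) ∩ L(A,B)`. -/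
def PL (Pf : AdmissibleFamily) (A : FdSubalgebra ι) (B : FdSubalgebra κ) : Set (HMap ι κ) :=
  Pf.P ι κ ∩ LAB A B

/-- The set `𝒞(A,B)` of `Pf`-channels, i.e. trace preserving maps in `Pf(A,B)`. -/
def ChanP (Pf : AdmissibleFamily) (A : FdSubalgebra ι) (B : FdSubalgebra κ) : Set (HMap ι κ) :=
  {φ | φ ∈ PL Pf A B ∧ TP φ}

/-- The dual cone `Pf*(A,B) = Pf*(H,K) ∩ L(A,B)`, where `Pf*(H,K) ⊆ L(H,K)` is the dual cone
of `Pf(K,H)` with respect to the pairing `⟨·,·⟩`. -/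
def PstarL (Pf : AdmissibleFamily) (A : FdSubalgebra ι) (B : FdSubalgebra κ) :
    Set (HMap ι κ) :=
  {ψ | IsHermMap ψ ∧ ψ ∈ LAB A B ∧ ∀ χ ∈ Pf.P κ ι, 0 ≤ pairing ψ χ}

/-- The diamond norm `‖φ‖_◇ = inf{λ>0 : ∃ α ∈ 𝒞(A,B), λα ± φ ∈ Pf(A,B)}`. -/
def dnormP (Pf : AdmissibleFamily) (A : FdSubalgebra ι) (B : FdSubalgebra κ)
    (φ : HMap ι κ) : ℝ :=
  sInf {l : ℝ | 0 < l ∧ ∃ α ∈ ChanP Pf A B,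
    (l • α - φ) ∈ PL Pf A B ∧ (l • α + φ) ∈ PL Pf A B}

/-- The dual diamond norm `‖φ‖^◇ = inf{λ>0 : ∃ σ ∈ 𝔖(B), λ Φ_{I,σ} ± φ ∈ Pf*(A,B)}`. -/
def udnormP (Pf : AdmissibleFamily) (A : FdSubalgebra ι) (B : FdSubalgebra κ)
    (φ : HMap ι κ) : ℝ :=
  sInf {l : ℝ | 0 < l ∧ ∃ σ ∈ States B,
    (l • PhiI ι σ - φ) ∈ PstarL Pf A B ∧ (l • PhiI ι σ + φ) ∈ PstarL Pf A B}

/-- `CP(A,B) = CP(H,K) ∩ L(A,B)`. -/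
def CPL (A : FdSubalgebra ι) (B : FdSubalgebra κ) : Set (HMap ι κ) :=
  CPSet ι κ ∩ LAB A B

/-- Completely positive trace preserving channels `A → B`. -/
def ChanCP (A : FdSubalgebra ι) (B : FdSubalgebra κ) : Set (HMap ι κ) :=
  {φ | φ ∈ CPL A B ∧ TP φ}

/-- The dual diamond norm with respect to the family `CP` (recall `CP* = CP`). -/
def udnormCP (A : FdSubalgebra ι) (B : FdSubalgebra κ) (φ : HMap ι κ) : ℝ :=
  sInf {l : ℝ | 0 < l ∧ ∃ σ ∈ States B,
    (l • PhiI ι σ - φ) ∈ CPL A B ∧ (l • PhiI ι σ + φ) ∈ CPL A B}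

/-- The qc-map `Φ^qc_A : b ↦ ∑_i Tr(A_i b) |e_i⟩⟨e_i|` given by operators `A_1, …, A_n`. -/
def PhiQC {n : ℕ} (A : Fin n → Mat ι) : HMap ι (Fin n) :=
  fun b => Matrix.diagonal fun i => (A i * b).trace

/-- The cq-map `Φ^cq_A : x ↦ ∑_i ⟨e_i, x e_i⟩ A_i` given by operators `A_1, …, A_n`. -/
def PhiCQ {n : ℕ} (A : Fin n → Mat ι) : HMap (Fin n) ι :=
  fun x => ∑ i, x i i • A i

/-- The trace norm `‖A‖₁ = Tr √(AᴴA)`. -/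
def traceNorm (A : Mat ι) : ℝ :=
  ((Matrix.posSemidef_conjTranspose_mul_self A).sqrt.trace).re

/-- The operator norm of a matrix. -/
def opNorm (A : Mat ι) : ℝ := ‖Matrix.toEuclideanCLM (𝕜 := ℂ) A‖

/-- The cone `C(~Pf(H,K)) ⊆ B_h(K ⊗ H)` of Choi matrices of adjoints of maps in the dual cone
`Pf*(K,H)`. -/
def tildeCone (Pf : AdmissibleFamily) (ι κ : Type) [Fintype ι] [DecidableEq ι]
    [Fintype κ] [DecidableEq κ] : Set (Mat (κ × ι)) :=
  {X | ∃ ψ : HMap κ ι, IsHermMap ψ ∧ (∀ χ ∈ Pf.P ι κ, 0 ≤ pairing χ ψ) ∧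
    X = Choi (adjFun ψ)}

/-- The base norm `‖X‖_{1,~Pf} = sup{Tr XY : -I ≤_{~Pf} Y ≤_{~Pf} I}` on `B_h(K ⊗ H)`. -/
def oneNormTilde (Pf : AdmissibleFamily) (X : Mat (κ × ι)) : ℝ :=
  sSup {r : ℝ | ∃ Y : Mat (κ × ι), (1 - Y) ∈ tildeCone Pf ι κ ∧ (1 + Y) ∈ tildeCone Pf ι κ ∧
    r = ((X * Y).trace).re}

/-- The order unit norm `‖X‖_C = inf{λ>0 : -λ1 ≤_C X ≤_C λ1}` for a cone `C` of matrices. -/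
def ordUnitNorm {α : Type} [Fintype α] [DecidableEq α] (C : Set (Mat α)) (X : Mat α) : ℝ :=
  sInf {l : ℝ | 0 < l ∧ (l • (1 : Mat α) - X) ∈ C ∧ (l • (1 : Mat α) + X) ∈ C}

open Classical in
/-- `(σ + ε I)^{-1/2}`. -/
def invSqrtShift (σ : Mat κ) (ε : ℝ) : Mat κ :=
  if h : (σ + (ε : ℂ) • 1).PosSemidef then h.sqrt⁻¹ else 0

variable {κ' δ : Type} [Fintype κ'] [DecidableEq κ'] [Fintype δ] [DecidableEq δ]

/-- `Ψ` is `(ε,D)`-post-processing deficient with respect to `Φ` (relative to the family `Pf`):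
for every payoff map `Γ ∈ Pf*(D,A)` and every `α ∈ 𝒞(B,D)` there is `α' ∈ 𝒞(B',D)` with
`⟨α∘Φ,Γ⟩ ≤ ⟨α'∘Ψ,Γ⟩ + ε‖Γ‖^◇`. -/
def PostDeficientP (Pf : AdmissibleFamily) (A : FdSubalgebra ι) (B : FdSubalgebra κ)
    (B' : FdSubalgebra κ') (D : FdSubalgebra δ) (Φ : HMap ι κ) (Ψ : HMap ι κ') (ε : ℝ) :
    Prop :=
  ∀ Γ ∈ PstarL Pf D A, ∀ α ∈ ChanP Pf B D, ∃ α' ∈ ChanP Pf B' D,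
    pairing (α ∘ Φ) Γ ≤ pairing (α' ∘ Ψ) Γ + ε * udnormP Pf D A Γ

/-- Post-processing deficiency for the admissible family `CP` (recall `CP* = CP`). -/
def PostDeficientCP (A : FdSubalgebra ι) (B : FdSubalgebra κ)
    (B' : FdSubalgebra κ') (D : FdSubalgebra δ) (Φ : HMap ι κ) (Ψ : HMap ι κ') (ε : ℝ) :
    Prop :=
  ∀ Γ ∈ CPL D A, ∀ α ∈ ChanCP B D, ∃ α' ∈ ChanCP B' D,
    pairing (α ∘ Φ) Γ ≤ pairing (α' ∘ Ψ) Γ + ε * udnormCP D A Γ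

variable {ι' : Type} [Fintype ι'] [DecidableEq ι']

/-- `Ψ` is `(ε,D)`-pre-processing deficient with respect to `Φ` (relative to `Pf`). -/
def PreDeficientP (Pf : AdmissibleFamily) (A : FdSubalgebra ι) (A' : FdSubalgebra ι')
    (B : FdSubalgebra κ) (D : FdSubalgebra δ) (Φ : HMap ι κ) (Ψ : HMap ι' κ) (ε : ℝ) :
    Prop :=
  ∀ Γ ∈ PstarL Pf B D, ∀ β ∈ ChanP Pf D A, ∃ β' ∈ ChanP Pf D A',
    pairing (Φ ∘ β) Γ ≤ pairing (Ψ ∘ β') Γ + ε * udnormP Pf B D Γ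

/-- Pre-processing deficiency for the admissible family `CP`. -/
def PreDeficientCP (A : FdSubalgebra ι) (A' : FdSubalgebra ι') (B : FdSubalgebra κ)
    (D : FdSubalgebra δ) (Φ : HMap ι κ) (Ψ : HMap ι' κ) (ε : ℝ) : Prop :=
  ∀ Γ ∈ CPL B D, ∀ β ∈ ChanCP D A, ∃ β' ∈ ChanCP D A',
    pairing (Φ ∘ β) Γ ≤ pairing (Ψ ∘ β') Γ + ε * udnormCP B D Γ

/-- `Ψ ⊇_ε Φ`: `sup_{σ ∈ SA} inf_{ρ ∈ SA'} ‖f(σ) - g(ρ)‖₁ ≤ 2ε`. -/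
def SupsetCond {α α' β : Type} [Fintype β] [DecidableEq β] (SA : Set (Mat α)) (SA' : Set (Mat α'))
    (f : Mat α → Mat β) (g : Mat α' → Mat β) (ε : ℝ) : Prop :=
  sSup {r : ℝ | ∃ σ ∈ SA, r = sInf {t : ℝ | ∃ ρ ∈ SA', t = traceNorm (f σ - g ρ)}} ≤ 2 * ε

end Main


section Helpers

open scoped MatrixOrder Matrix.Norms.L2Operator in
lemma herm_bound_one {n : Type} [Fintype n] [DecidableEq n] (F : Mat n) (hF : F.IsHermitian) :
    ∃ f : ℝ, 0 ≤ f ∧ (f • (1 : Mat n) - F).PosSemidef := by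
  have h : IsSelfAdjoint F := hF
  refine ⟨‖F‖, norm_nonneg _, ?_⟩
  have := IsSelfAdjoint.le_algebraMap_norm_self h
  rw [Matrix.le_iff, Algebra.algebraMap_eq_smul_one] at this
  exact this

lemma psd_smul_one {n : Type} [Fintype n] [DecidableEq n] (f : ℝ) (hf : 0 ≤ f) :
    (f • (1 : Mat n)).PosSemidef := by
  exact Matrix.PosSemidef.one.smul hf

lemma herm_bound {n : Type} [Fintype n] [DecidableEq n] (F : Mat n) (hF : F.IsHermitian) :
    ∃ f : ℝ, 0 ≤ f ∧ (f • (1 : Mat n) - F).PosSemidef ∧ (f • (1 : Mat n) + F).PosSemidef := by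
  obtain ⟨f, hf, h1⟩ := herm_bound_one F hF
  obtain ⟨g, hg, h2⟩ := herm_bound_one (-F) hF.neg
  refine ⟨f + g, add_nonneg hf hg, ?_, ?_⟩
  · have := h1.add (psd_smul_one (n := n) g hg)
    convert this using 1
    rw [add_smul]; abel
  · have := h2.add (psd_smul_one (n := n) f hf)
    convert this using 1
    rw [add_smul]; abel

open scoped MatrixOrder Matrix.Norms.L2Operator in
lemma trace_mul_psd {n : Type} [Fintype n] [DecidableEq n] {F X : Mat n} (hF : F.PosSemidef)
    (hX : X.PosSemidef) : 0 ≤ (F * X).trace.re := by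
  obtain ⟨C, rfl⟩ : ∃ C : Mat n, F = Cᴴ * C := by
    obtain ⟨C, hC⟩ := CStarAlgebra.nonneg_iff_eq_star_mul_self.mp hF.nonneg
    exact ⟨C, hC⟩
  have : (Cᴴ * C * X).trace = (C * X * Cᴴ).trace := by
    rw [Matrix.mul_assoc, Matrix.trace_mul_comm]
  rw [this]
  have h := (hX.mul_mul_conjTranspose_same C).trace_nonneg
  exact (Complex.le_def.mp h).1

variable {ι κ μ : Type} [Fintype ι] [DecidableEq ι] [Fintype κ] [DecidableEq κ]
  [Fintype μ] [DecidableEq μ]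

/-- Elementary rank-one maps `a ↦ Tr(F a) ρ`. -/
def elemMap (F : Mat ι) (ρ : Mat κ) : HMap ι κ := fun a => (F * a).trace • ρ

/-- Convex cones of maps containing the elementary entanglement breaking maps. -/
structure EBCone (Q : Set (HMap ι κ)) : Prop where
  add : ∀ x ∈ Q, ∀ y ∈ Q, x + y ∈ Q
  smul : ∀ c : ℝ, 0 ≤ c → ∀ x ∈ Q, c • x ∈ Q
  elem : ∀ F ρ, F.PosSemidef → ρ.PosSemidef → elemMap F ρ ∈ Q

/-- Maps dominated by a multiple of `Tr(·) 1`. -/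
def Dom (Q : Set (HMap ι κ)) (φ : HMap ι κ) : Prop :=
  ∃ l : ℝ, 0 ≤ l ∧ (l • elemMap 1 1 - φ) ∈ Q ∧ (l • elemMap 1 1 + φ) ∈ Q

lemma Dom.add {Q : Set (HMap ι κ)} (hQ : EBCone Q) {x y : HMap ι κ} (hx : Dom Q x)
    (hy : Dom Q y) : Dom Q (x + y) := by
  obtain ⟨l, hl, h1, h2⟩ := hx
  obtain ⟨m, hm, h3, h4⟩ := hy
  refine ⟨l + m, add_nonneg hl hm, ?_, ?_⟩
  · convert hQ.add _ h1 _ h3 using 1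
    rw [add_smul]; abel
  · convert hQ.add _ h2 _ h4 using 1
    rw [add_smul]; abel

lemma Dom.zero {Q : Set (HMap ι κ)} (hQ : EBCone Q) : Dom Q (0 : HMap ι κ) := by
  have := hQ.smul 0 le_rfl _ (hQ.elem 1 1 .one .one)
  exact ⟨0, le_rfl, by simpa using this, by simpa using this⟩

lemma Dom.sum {Q : Set (HMap ι κ)} (hQ : EBCone Q) {α : Type*} (s : Finset α)
    (f : α → HMap ι κ) (h : ∀ a ∈ s, Dom Q (f a)) : Dom Q (∑ a ∈ s, f a) :=
  Finset.sum_induction f (Dom Q) (fun _ _ hx hy => hx.add hQ hy) (Dom.zero hQ) h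

lemma Dom.elem {Q : Set (HMap ι κ)} (hQ : EBCone Q) {F : Mat ι} {ρ : Mat κ}
    (hF : F.IsHermitian) (hρ : ρ.IsHermitian) : Dom Q (elemMap F ρ) := by
  obtain ⟨f, hf, f1, f2⟩ := herm_bound F hF
  obtain ⟨r, hr, r1, r2⟩ := herm_bound ρ hρ
  refine ⟨f * r, mul_nonneg hf hr, ?_, ?_⟩
  · convert hQ.smul (1/2) (by norm_num) _
      (hQ.add _ (hQ.elem _ _ f1 r2) _ (hQ.elem _ _ f2 r1)) using 1
    ext a i j
    simp [elemMap, sub_mul, add_mul, Matrix.trace_add, Matrix.trace_sub, Matrix.trace_smul]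
    ring
  · convert hQ.smul (1/2) (by norm_num) _
      (hQ.add _ (hQ.elem _ _ f1 r1) _ (hQ.elem _ _ f2 r2)) using 1
    ext a i j
    simp [elemMap, sub_mul, add_mul, Matrix.trace_add, Matrix.trace_sub, Matrix.trace_smul]
    ring

lemma lin_expand {f : HMap ι κ} (hf : IsLinearMap ℂ f) (a : Mat ι) :
    f a = ∑ i, ∑ j, a i j • f (Matrix.single i j 1) := by
  conv_lhs => rw [Matrix.matrix_eq_sum_single a]
  have h := map_sum hf.mk' (fun i => ∑ j, Matrix.single i j (a i j)) Finset.univ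
  simp only [IsLinearMap.mk'_apply] at h
  rw [h]
  refine Finset.sum_congr rfl fun i _ => ?_
  have h := map_sum hf.mk' (fun j => Matrix.single i j (a i j)) Finset.univ
  simp only [IsLinearMap.mk'_apply] at h
  rw [h]
  refine Finset.sum_congr rfl fun j _ => ?_
  rw [← hf.map_smul]
  simp

lemma dom_of_herm {Q : Set (HMap ι κ)} (hQ : EBCone Q) {φ : HMap ι κ} (hφ : IsHermMap φ) :
    Dom Q φ := by
  let X : ι → ι → Mat κ := fun i j => φ (Matrix.single i j 1)
  have hX : ∀ i j, X j i = (X i j)ᴴ := by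
    intro i j
    simp only [X]
    rw [← hφ.2]; simp
  have key : φ = ∑ i, ∑ j,
      (elemMap (Matrix.single i j 1 + Matrix.single j i 1)
          ((1/4 : ℂ) • (X i j + (X i j)ᴴ)) +
       elemMap (Complex.I • (Matrix.single j i 1 - Matrix.single i j 1))
          ((Complex.I/4 : ℂ) • ((X i j)ᴴ - X i j))) := by
    have h2 : ∀ a, φ a = ∑ i, ∑ j, ((1/2 : ℂ) • (a i j • X i j + a j i • (X i j)ᴴ)) := by
      intro a
      have e1 := lin_expand hφ.1 a
      have e2 : φ a = ∑ i, ∑ j, a j i • (X i j)ᴴ := by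
        rw [e1, Finset.sum_comm]
        refine Finset.sum_congr rfl fun i _ => Finset.sum_congr rfl fun j _ => ?_
        rw [← hX]
      have : φ a = (1/2 : ℂ) • (φ a + φ a) := by
        rw [← two_smul ℂ, smul_smul]; norm_num
      rw [this]
      nth_rewrite 1 [e1]
      rw [e2]
      simp only [← Finset.sum_add_distrib, Finset.smul_sum, X]
    funext a
    rw [h2]
    simp only [Finset.sum_apply, Pi.add_apply]
    refine Finset.sum_congr rfl fun i _ => Finset.sum_congr rfl fun j _ => ?_
    have ht : ∀ i j, (Matrix.single i j (1:ℂ) * a).trace = a j i := by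
      intro i j
      simp [Matrix.trace_single_mul]
    simp only [elemMap, add_mul, smul_mul_assoc, sub_mul, Matrix.trace_add, Matrix.trace_sub,
      Matrix.trace_smul, ht]
    ext k l
    simp
    ring_nf
    simp
    ring
  rw [key]
  refine Dom.sum hQ _ _ fun i _ => Dom.sum hQ _ _ fun j _ => Dom.add hQ ?_ ?_
  · refine Dom.elem hQ ?_ ?_
    · simp [Matrix.IsHermitian, add_comm]
    · simp [Matrix.IsHermitian, add_comm]
  · refine Dom.elem hQ ?_ ?_
    · simp [Matrix.IsHermitian, ← smul_neg]
    · simp [Matrix.IsHermitian, ← smul_neg, neg_div]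

lemma sC_comm {f : HMap κ ι} {g : HMap ι κ} (hf : IsLinearMap ℂ f) (hg : IsLinearMap ℂ g) :
    sC (f ∘ g) = sC (g ∘ f) := by
  have e1 : sC (f ∘ g) = ∑ i, ∑ j, ∑ k, ∑ l,
      g (Matrix.single i j 1) k l * f (Matrix.single k l 1) i j := by
    unfold sC
    refine Finset.sum_congr rfl fun i _ => Finset.sum_congr rfl fun j _ => ?_
    rw [Function.comp_apply, lin_expand hf]
    simp [Matrix.sum_apply]
  have e2 : sC (g ∘ f) = ∑ k, ∑ l, ∑ i, ∑ j,
      g (Matrix.single i j 1) k l * f (Matrix.single k l 1) i j := by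
    unfold sC
    refine Finset.sum_congr rfl fun i _ => Finset.sum_congr rfl fun j _ => ?_
    rw [Function.comp_apply, lin_expand hg]
    simp [Matrix.sum_apply, mul_comm]
  rw [e1, e2]
  simp only [← Finset.sum_product', Finset.univ_product_univ]
  simp only [Fintype.sum_prod_type]
  have := Finset.sum_comm (s := (Finset.univ : Finset (ι × ι)))
    (t := (Finset.univ : Finset (κ × κ)))
    (f := fun p q => g (Matrix.single p.1 p.2 1) q.1 q.2 * f (Matrix.single q.1 q.2 1) p.1 p.2)
  simpa only [Fintype.sum_prod_type] using this

lemma IsHermMap.comp {f : HMap κ μ} {g : HMap ι κ} (hf : IsHermMap f) (hg : IsHermMap g) :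
    IsHermMap (f ∘ g) :=
  ⟨(hf.1.mk'.comp hg.1.mk').isLinear, fun a => by simp [hg.2, hf.2]⟩

lemma IsHermMap.add {f g : HMap ι κ} (hf : IsHermMap f) (hg : IsHermMap g) :
    IsHermMap (f + g) :=
  ⟨(hf.1.mk' + hg.1.mk').isLinear, fun a => by simp [hg.2, hf.2]⟩

lemma IsHermMap.smul {f : HMap ι κ} (hf : IsHermMap f) (c : ℝ) : IsHermMap (c • f) :=
  ⟨(c • hf.1.mk').isLinear, fun a => by simp [hf.2]⟩

lemma isHermMap_elem {F : Mat ι} {ρ : Mat κ} (hF : F.IsHermitian) (hρ : ρ.IsHermitian) :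
    IsHermMap (elemMap F ρ) := by
  refine ⟨⟨?_, ?_⟩, ?_⟩
  · intro x y; simp [elemMap, mul_add, add_smul]
  · intro c x; simp [elemMap, smul_smul]
  · intro a
    have : (F * aᴴ).trace = star (F * a).trace := by
      rw [← Matrix.trace_conjTranspose, Matrix.conjTranspose_mul, hF.eq, Matrix.trace_mul_comm]
    simp only [elemMap, this, Matrix.conjTranspose_smul, hρ.eq]

/-- The dual cone on the full matrix algebras. -/
def PstarHK (Pf : AdmissibleFamily) (ι κ : Type) [Fintype ι] [DecidableEq ι]
    [Fintype κ] [DecidableEq κ] : Set (HMap ι κ) :=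
  {ψ | IsHermMap ψ ∧ ∀ χ ∈ Pf.P κ ι, 0 ≤ pairing ψ χ}

lemma pairing_add {f g : HMap ι κ} {χ : HMap κ ι} (hχ : IsLinearMap ℂ χ) :
    pairing (f + g) χ = pairing f χ + pairing g χ := by
  simp [pairing, sC, hχ.map_add, Finset.sum_add_distrib]

lemma pairing_smul {f : HMap ι κ} {χ : HMap κ ι} (hχ : IsLinearMap ℂ χ) (c : ℝ) :
    pairing (c • f) χ = c * pairing f χ := by
  have : ∀ x : Mat κ, χ (c • x) = c • χ x := fun x => (hχ.mk'.restrictScalars ℝ).map_smul c x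
  simp [pairing, sC, this, Finset.mul_sum]

lemma ebCone_P (Pf : AdmissibleFamily) : EBCone (Pf.P ι κ) := by
  obtain ⟨_, _, hc, hs, _, _⟩ := Pf.proper ι κ
  refine ⟨?_, hs, ?_⟩
  · intro x hx y hy
    have := hs 2 (by norm_num) _ (hc hx hy (a := 1/2) (b := 1/2) (by norm_num) (by norm_num)
      (by norm_num))
    convert this using 1
    rw [smul_add, smul_smul, smul_smul]; norm_num
  · intro F ρ hF hρ
    refine Pf.eb_le ι κ ⟨1, fun _ => F, fun _ => ρ, fun _ => hF, fun _ => hρ, ?_⟩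
    funext a; simp [elemMap]

lemma ebCone_Pstar (Pf : AdmissibleFamily) : EBCone (PstarHK Pf ι κ) := by
  refine ⟨?_, ?_, ?_⟩
  · intro x hx y hy
    refine ⟨hx.1.add hy.1, fun χ hχ => ?_⟩
    rw [pairing_add (Pf.le_pos _ _ hχ).1.1]
    exact add_nonneg (hx.2 χ hχ) (hy.2 χ hχ)
  · intro c hc x hx
    refine ⟨hx.1.smul c, fun χ hχ => ?_⟩
    rw [pairing_smul (Pf.le_pos _ _ hχ).1.1]
    exact mul_nonneg hc (hx.2 χ hχ)
  · intro F ρ hF hρ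
    refine ⟨isHermMap_elem hF.1 hρ.1, fun χ hχ => ?_⟩
    have hχ' := Pf.le_pos _ _ hχ
    have : pairing (elemMap F ρ) χ = (F * χ ρ).trace.re := by
      unfold pairing sC
      congr 1
      have : ∀ i j, (F * Matrix.single i j (1:ℂ)).trace = F j i := by
        intro i j; simp [Matrix.trace_mul_single]
      simp only [Function.comp_apply, elemMap, hχ'.1.1.map_smul, this, Matrix.smul_apply,
        smul_eq_mul]
      rw [Finset.sum_comm]
      simp [Matrix.trace, Matrix.mul_apply]
    rw [this]
    exact trace_mul_psd hF (hχ'.2 ρ hρ)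

lemma id_mem_CP : (id : HMap ι ι) ∈ CPSet ι ι :=
  ⟨⟨⟨fun _ _ => rfl, fun _ _ => rfl⟩, fun _ => rfl⟩, fun _ _ h => h⟩

lemma P_post (Pf : AdmissibleFamily) {β : HMap κ μ} (hβ : β ∈ Pf.P κ μ ∨ β ∈ CPSet κ μ)
    {χ : HMap ι κ} (hχ : χ ∈ Pf.P ι κ) : β ∘ χ ∈ Pf.P ι μ := by
  rcases hβ with h | h
  · exact Pf.comp_mem _ _ _ _ hχ _ h
  · exact Pf.cp_comp_mem _ _ _ _ _ id_mem_CP _ hχ _ h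

lemma P_pre (Pf : AdmissibleFamily) {α : HMap ι κ} (hα : α ∈ Pf.P ι κ ∨ α ∈ CPSet ι κ)
    {χ : HMap κ μ} (hχ : χ ∈ Pf.P κ μ) : χ ∘ α ∈ Pf.P ι μ := by
  rcases hα with h | h
  · exact Pf.comp_mem _ _ _ _ h _ hχ
  · exact Pf.cp_comp_mem _ _ _ _ _ h _ hχ _ id_mem_CP

lemma good_herm (Pf : AdmissibleFamily) {α : HMap ι κ} (hα : α ∈ Pf.P ι κ ∨ α ∈ CPSet ι κ) :
    IsHermMap α := by
  rcases hα with h | h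
  · exact (Pf.le_pos _ _ h).1
  · exact h.1

lemma good_pos (Pf : AdmissibleFamily) {β : HMap κ μ} (hβ : β ∈ Pf.P κ μ ∨ β ∈ CPSet κ μ)
    {σ : Mat κ} (hσ : σ.PosSemidef) : (β σ).PosSemidef := by
  have h1 := P_post Pf hβ ((ebCone_P (ι := Unit) Pf).elem 1 σ .one hσ)
  have := (Pf.le_pos _ _ h1).2 1 .one
  simpa [elemMap] using this

lemma PL_smul (Pf : AdmissibleFamily) {A : FdSubalgebra ι} {B : FdSubalgebra κ} {φ : HMap ι κ}
    (h : φ ∈ LAB A B) (c : ℝ) : c • φ ∈ LAB A B := by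
  refine ⟨fun a => ?_, fun a => ?_⟩
  · have := B.smul_mem (c : ℂ) (h.1 a)
    simpa using this
  · simp [h.2]

lemma LAB_add {A : FdSubalgebra ι} {B : FdSubalgebra κ} {φ ψ : HMap ι κ}
    (h : φ ∈ LAB A B) (h' : ψ ∈ LAB A B) : φ + ψ ∈ LAB A B :=
  ⟨fun a => B.add_mem (h.1 a) (h'.1 a), fun a => by simp [h.2, h'.2]⟩

lemma LAB_sub (Pf : AdmissibleFamily) {A : FdSubalgebra ι} {B : FdSubalgebra κ} {φ ψ : HMap ι κ}
    (h : φ ∈ LAB A B) (h' : ψ ∈ LAB A B) : φ - ψ ∈ LAB A B := by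
  have := LAB_add h (PL_smul Pf h' (-1))
  rwa [neg_one_smul, ← sub_eq_add_neg] at this

lemma LAB_comp {A : FdSubalgebra ι} {B : FdSubalgebra κ} {C : FdSubalgebra μ} {φ : HMap ι κ}
    {ψ : HMap κ μ} (h : φ ∈ LAB A B) (h' : ψ ∈ LAB B C) : ψ ∘ φ ∈ LAB A C :=
  ⟨fun a => h'.1 _, fun a => by simp [h.2]⟩

lemma PhiI_LAB (A : FdSubalgebra ι) (B : FdSubalgebra κ) {σ : Mat κ} (hσ : σ ∈ B.car) :
    PhiI ι σ ∈ LAB A B := by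
  refine ⟨fun a => B.smul_mem _ hσ, fun a => ?_⟩
  have := A.E_trace a 1 A.one_mem
  simp only [mul_one] at this
  simp [PhiI, this]

/-- The maximally mixed state. -/
def mm (κ : Type) [Fintype κ] [DecidableEq κ] : Mat κ :=
  ((Fintype.card κ : ℝ)⁻¹) • (1 : Mat κ)

lemma mm_states [Nonempty κ] (B : FdSubalgebra κ) : mm κ ∈ States B := by
  have hc : (Fintype.card κ : ℂ) ≠ 0 := by simp
  refine ⟨?_, psd_smul_one _ (by positivity), ?_⟩
  · have := B.smul_mem (((Fintype.card κ : ℝ)⁻¹ : ℝ) : ℂ) B.one_mem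
    rwa [Complex.coe_smul] at this
  · simp [mm, Matrix.trace_smul]

/-- A common nonemptiness statement. -/
lemma dom_mm [Nonempty κ] {Q : Set (HMap ι κ)} (hQ : EBCone Q) {φ : HMap ι κ}
    (hφ : IsHermMap φ) : ∃ l : ℝ, 0 < l ∧ (l • PhiI ι (mm κ) - φ) ∈ Q ∧
      (l • PhiI ι (mm κ) + φ) ∈ Q := by
  obtain ⟨l, hl, h1, h2⟩ := dom_of_herm hQ hφ
  have hc : (0 : ℝ) < Fintype.card κ := by exact_mod_cast Fintype.card_pos
  have h0 := hQ.elem (1 : Mat ι) (1 : Mat κ) .one .one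
  have e : ((l + 1) * Fintype.card κ) • PhiI ι (mm κ) = l • elemMap 1 1 + elemMap 1 1 := by
    funext a
    simp only [Pi.smul_apply, Pi.add_apply, PhiI, mm, elemMap, one_mul]
    rw [smul_comm a.trace, smul_smul, mul_assoc, mul_inv_cancel₀ hc.ne', mul_one, add_smul,
      one_smul]
  refine ⟨(l + 1) * Fintype.card κ, by positivity, ?_, ?_⟩
  · rw [e]; convert hQ.add _ h1 _ h0 using 1; abel
  · rw [e]; convert hQ.add _ h2 _ h0 using 1; abel

lemma PstarL_iff (Pf : AdmissibleFamily) (A : FdSubalgebra ι) (B : FdSubalgebra κ)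
    (ψ : HMap ι κ) : ψ ∈ PstarL Pf A B ↔ ψ ∈ PstarHK Pf ι κ ∧ ψ ∈ LAB A B := by
  simp only [PstarL, PstarHK, Set.mem_setOf_eq]; tauto

lemma sInf_scale {S : Set ℝ} (hS : ∀ l ∈ S, 0 < l) (h : ∀ l ∈ S, ∀ e : ℝ, 0 < e → e ∈ S) :
    sInf S ≤ 0 := by
  rcases S.eq_empty_or_nonempty with rfl | ⟨l, hl⟩
  · simp
  · refine le_of_forall_pos_le_add fun e he => ?_
    rw [zero_add]
    exact csInf_le ⟨0, fun x hx => (hS x hx).le⟩ (h l hl e he)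

lemma dnorm_zero (Pf : AdmissibleFamily) (A : FdSubalgebra ι) (B : FdSubalgebra κ) :
    dnormP Pf A B 0 ≤ 0 := by
  refine sInf_scale (fun l hl => hl.1) ?_
  rintro l ⟨_, α, hα, _, _⟩ e he
  have : e • α ∈ PL Pf A B := ⟨(ebCone_P Pf).smul e he.le _ hα.1.1, PL_smul Pf hα.1.2 e⟩
  exact ⟨he, α, hα, by simpa using this, by simpa using this⟩

lemma udnorm_zero (Pf : AdmissibleFamily) (A : FdSubalgebra ι) (B : FdSubalgebra κ) :
    udnormP Pf A B 0 ≤ 0 := by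
  refine sInf_scale (fun l hl => hl.1) ?_
  rintro l ⟨_, σ, hσ, _, _⟩ e he
  have h1 : PhiI ι σ ∈ PstarHK Pf ι κ := by
    have := (ebCone_Pstar Pf).elem (1 : Mat ι) σ .one hσ.2.1
    convert this using 1
    funext a; simp [PhiI, elemMap]
  have : e • PhiI ι σ ∈ PstarL Pf A B := by
    rw [PstarL_iff]
    exact ⟨(ebCone_Pstar Pf).smul e he.le _ h1, PL_smul Pf (PhiI_LAB A B hσ.1) e⟩
  exact ⟨he, σ, hσ, by simpa using this, by simpa using this⟩

lemma dnorm_nonneg (Pf : AdmissibleFamily) (A : FdSubalgebra ι) (B : FdSubalgebra κ)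
    (φ : HMap ι κ) : 0 ≤ dnormP Pf A B φ := Real.sInf_nonneg fun _ h => h.1.le

lemma udnorm_nonneg (Pf : AdmissibleFamily) (A : FdSubalgebra ι) (B : FdSubalgebra κ)
    (φ : HMap ι κ) : 0 ≤ udnormP Pf A B φ := Real.sInf_nonneg fun _ h => h.1.le

lemma dnorm_set_nonempty [Nonempty κ] (Pf : AdmissibleFamily) (A : FdSubalgebra ι)
    (B : FdSubalgebra κ) {φ : HMap ι κ} (hφ : IsHermMap φ) (hL : φ ∈ LAB A B) :
    {l : ℝ | 0 < l ∧ ∃ α ∈ ChanP Pf A B,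
      (l • α - φ) ∈ PL Pf A B ∧ (l • α + φ) ∈ PL Pf A B}.Nonempty := by
  obtain ⟨l, hl, h1, h2⟩ := dom_mm (ebCone_P Pf) hφ
  have hm := mm_states B
  have hP := PhiI_LAB A B hm.1
  have hl' := PL_smul Pf hP l
  refine ⟨l, hl, PhiI ι (mm κ), ⟨⟨?_, hP⟩, ?_⟩, ⟨h1, LAB_sub Pf hl' hL⟩, ⟨h2, LAB_add hl' hL⟩⟩
  · have := (ebCone_P Pf).elem (1 : Mat ι) _ .one hm.2.1
    convert this using 1
    funext a; simp [PhiI, elemMap]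
  · intro a
    simp [PhiI, Matrix.trace_smul, hm.2.2]

lemma udnorm_set_nonempty [Nonempty κ] (Pf : AdmissibleFamily) (A : FdSubalgebra ι)
    (B : FdSubalgebra κ) {φ : HMap ι κ} (hφ : IsHermMap φ) (hL : φ ∈ LAB A B) :
    {l : ℝ | 0 < l ∧ ∃ σ ∈ States B, (l • PhiI ι σ - φ) ∈ PstarL Pf A B ∧
      (l • PhiI ι σ + φ) ∈ PstarL Pf A B}.Nonempty := by
  obtain ⟨l, hl, h1, h2⟩ := dom_mm (ebCone_Pstar Pf) hφ
  have hm := mm_states B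
  have hl' := PL_smul Pf (PhiI_LAB A B hm.1) l
  refine ⟨l, hl, mm κ, hm, ?_, ?_⟩
  · rw [PstarL_iff]; exact ⟨h1, LAB_sub Pf hl' hL⟩
  · rw [PstarL_iff]; exact ⟨h2, LAB_add hl' hL⟩

lemma Pstar_comp (Pf : AdmissibleFamily) {ν : Type} [Fintype ν] [DecidableEq ν]
    {α : HMap ι κ} (hα : α ∈ Pf.P ι κ ∨ α ∈ CPSet ι κ)
    {β : HMap μ ν} (hβ : β ∈ Pf.P μ ν ∨ β ∈ CPSet μ ν)
    {ψ : HMap κ μ} (hψ : ψ ∈ PstarHK Pf κ μ) : β ∘ ψ ∘ α ∈ PstarHK Pf ι ν := by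
  have ha := good_herm Pf hα
  have hb := good_herm Pf hβ
  refine ⟨hb.comp (hψ.1.comp ha), fun χ hχ => ?_⟩
  have hx := (Pf.le_pos _ _ hχ).1
  have h := hψ.2 (α ∘ χ ∘ β) (P_post Pf hα (P_pre Pf hβ hχ))
  have e : pairing (β ∘ ψ ∘ α) χ = pairing ψ (α ∘ χ ∘ β) := by
    unfold pairing
    congr 1
    exact sC_comm (f := χ ∘ β ∘ ψ) (g := α) (hx.comp (hb.comp hψ.1)).1 ha.1
  rw [e]; exact h

lemma comp_lin {ν : Type} [Fintype ν] [DecidableEq ν] {β : HMap μ ν} (hβ : IsLinearMap ℂ β)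
    (α : HMap ι κ) (φ ψ : HMap κ μ) (l : ℝ) :
    (β ∘ (l • φ - ψ) ∘ α = l • (β ∘ φ ∘ α) - β ∘ ψ ∘ α) ∧
    (β ∘ (l • φ + ψ) ∘ α = l • (β ∘ φ ∘ α) + β ∘ ψ ∘ α) := by
  have : ∀ x, β (l • x) = l • β x := fun x => (hβ.mk'.restrictScalars ℝ).map_smul l x
  constructor
  · funext a; simp [hβ.map_sub, this]
  · funext a; simp [hβ.map_add, this]

end Helpers

/-- Monotonicity of the diamond norm and its dual under pre- and post-composition with
(`𝒫`- or CP-) channels. -/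
theorem statement4 (Pf : AdmissibleFamily) {ι ι' κ κ' : Type}
    [Fintype ι] [DecidableEq ι] [Fintype ι'] [DecidableEq ι']
    [Fintype κ] [DecidableEq κ] [Fintype κ'] [DecidableEq κ']
    (A : FdSubalgebra ι) (A' : FdSubalgebra ι') (B : FdSubalgebra κ) (B' : FdSubalgebra κ')
    (φ : HMap ι κ) (hφ : IsHermMap φ) (hφL : φ ∈ LAB A B)
    (α : HMap ι' ι) (hα : (α ∈ PL Pf A' A ∨ α ∈ CPL A' A) ∧ TP α)
    (β : HMap κ κ') (hβ : (β ∈ PL Pf B B' ∨ β ∈ CPL B B') ∧ TP β) :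
    dnormP Pf A' B' (β ∘ φ ∘ α) ≤ dnormP Pf A B φ ∧
    udnormP Pf A' B' (β ∘ φ ∘ α) ≤ udnormP Pf A B φ := by
  obtain ⟨hα, hαT⟩ := hα
  obtain ⟨hβ, hβT⟩ := hβ
  have hαL : α ∈ LAB A' A := hα.elim (fun h => h.2) (fun h => h.2)
  have hβL : β ∈ LAB B B' := hβ.elim (fun h => h.2) (fun h => h.2)
  replace hα : α ∈ Pf.P ι' ι ∨ α ∈ CPSet ι' ι := hα.imp (fun h => h.1) (fun h => h.1)
  replace hβ : β ∈ Pf.P κ κ' ∨ β ∈ CPSet κ κ' := hβ.imp (fun h => h.1) (fun h => h.1)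
  have hb := good_herm Pf hβ
  rcases isEmpty_or_nonempty κ with hκ | hκ
  · have h0 : β ∘ φ ∘ α = 0 := by
      funext a
      have : φ (α a) = 0 := Subsingleton.elim _ _
      simp [this, hb.1.map_zero]
    rw [h0]
    exact ⟨(dnorm_zero Pf A' B').trans (dnorm_nonneg Pf A B φ),
      (udnorm_zero Pf A' B').trans (udnorm_nonneg Pf A B φ)⟩
  · constructor
    · refine csInf_le_csInf ⟨0, fun x hx => hx.1.le⟩ (dnorm_set_nonempty Pf A B hφ hφL) ?_
      rintro l ⟨hl, γ, ⟨⟨hγ, hγL⟩, hγT⟩, h1, h2⟩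
      obtain ⟨e1, e2⟩ := comp_lin hb.1 α γ φ l
      refine ⟨hl, β ∘ γ ∘ α, ⟨⟨P_post Pf hβ (P_pre Pf hα hγ),
        LAB_comp (LAB_comp hαL hγL) hβL⟩, fun a => ?_⟩, ?_, ?_⟩
      · simp only [Function.comp_apply]
        rw [hβT, hγT, hαT]
      · rw [← e1]
        exact ⟨P_post Pf hβ (P_pre Pf hα h1.1), LAB_comp (LAB_comp hαL h1.2) hβL⟩
      · rw [← e2]
        exact ⟨P_post Pf hβ (P_pre Pf hα h2.1), LAB_comp (LAB_comp hαL h2.2) hβL⟩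
    · refine csInf_le_csInf ⟨0, fun x hx => hx.1.le⟩ (udnorm_set_nonempty Pf A B hφ hφL) ?_
      rintro l ⟨hl, σ, hσ, h1, h2⟩
      obtain ⟨e1, e2⟩ := comp_lin hb.1 α (PhiI ι σ) φ l
      have e : β ∘ PhiI ι σ ∘ α = PhiI ι' (β σ) := by
        funext a
        simp only [Function.comp_apply, PhiI]
        rw [hb.1.map_smul, hαT]
      rw [e] at e1 e2
      rw [PstarL_iff] at h1 h2
      refine ⟨hl, β σ, ⟨hβL.1 σ, good_pos Pf hβ hσ.2.1, (hβT σ).trans hσ.2.2⟩, ?_, ?_⟩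
      · rw [← e1, PstarL_iff]
        exact ⟨Pstar_comp Pf hα hβ h1.1, LAB_comp (LAB_comp hαL h1.2) hβL⟩
      · rw [← e2, PstarL_iff]
        exact ⟨Pstar_comp Pf hα hβ h2.1, LAB_comp (LAB_comp hαL h2.2) hβL⟩
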